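/- Let m ≥ 2 be a natural number and let (A,+,·) be a left brace with A^{(3)} = {0} and A^{m+1} = {0}. Let a ∈ A and define a_1 = a, a_{j+1} = a*a_j for j ≥ 1. Then the set S = {∑_{k=1}^m t_k·a_k : t_1,…,t_m ∈ ℤ} is the subbrace of A generated by a; that is, S is a subgroup of (A,+), S is closed under · and under multiplicative inverses, a ∈ S, and S is contained in every subbrace of A containing a. -/

import Mathlib

/-- `λ_a(b) = -a + a·b` for a left-brace multiplication `mul`. -/
def braceLam {A : Type*} [AddCommGroup A] (mul : A → A → A) (a b : A) : A :=
  -a + mul a b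

/-- The star operation `a * b = λ_a(b) - b`. -/
def braceStar {A : Type*} [AddCommGroup A] (mul : A → A → A) (a b : A) : A :=
  braceLam mul a b - b

/-- `rightSeries mul r` is `A^{(r+1)}` of the paper: `rightSeries mul 0 = A^{(1)} = A` and
`rightSeries mul (r+1) = A^{(r+2)} = A^{(r+1)} * A`, the additive subgroup generated by
star products of elements of `A^{(r+1)}` with elements of `A`. -/
def rightSeries {A : Type*} [AddCommGroup A] (mul : A → A → A) : ℕ → AddSubgroup A
  | 0 => ⊤
  | r + 1 => AddSubgroup.closure {x | ∃ z c, z ∈ rightSeries mul r ∧ x = braceStar mul z c}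

/-- `leftSeries mul r` is `A^{r+1}` of the paper: `leftSeries mul 0 = A^1 = A` and
`leftSeries mul (r+1) = A^{r+2} = A * A^{r+1}`, the additive subgroup generated by
star products of elements of `A` with elements of `A^{r+1}`. -/
def leftSeries {A : Type*} [AddCommGroup A] (mul : A → A → A) : ℕ → AddSubgroup A
  | 0 => ⊤
  | r + 1 => AddSubgroup.closure {x | ∃ c z, z ∈ leftSeries mul r ∧ x = braceStar mul c z}

section LeftBrace

variable {A : Type*} [AddCommGroup A] {mul : A → A → A}

theorem mul_eq_add_braceLam (mul : A → A → A) (x y : A) : mul x y = x + braceLam mul x y := by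
  simp [braceLam]

theorem braceLam_eq_braceStar_add (x y : A) : braceLam mul x y = braceStar mul x y + y := by
  simp [braceStar]

theorem braceLam_add (hdist : ∀ a b c : A, mul a (b + c) = mul a b - a + mul a c) (x y z : A) :
    braceLam mul x (y + z) = braceLam mul x y + braceLam mul x z := by
  simp only [braceLam, hdist]
  abel

theorem braceLam_zero_left (hzl : ∀ a : A, mul 0 a = a) (x : A) : braceLam mul 0 x = x := by
  simp [braceLam, hzl]

theorem braceLam_mul (hassoc : ∀ a b c : A, mul (mul a b) c = mul a (mul b c))
    (hdist : ∀ a b c : A, mul a (b + c) = mul a b - a + mul a c) (x y z : A) :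
    braceLam mul (mul x y) z = braceLam mul x (braceLam mul y z) := by
  have h := hdist x y (braceLam mul y z)
  rw [← mul_eq_add_braceLam mul, ← hassoc] at h
  simp only [braceLam] at h ⊢
  rw [h]
  abel

theorem braceStar_mem_rightSeries_one (x y : A) : braceStar mul x y ∈ rightSeries mul 1 :=
  AddSubgroup.subset_closure ⟨x, y, AddSubgroup.mem_top x, rfl⟩

/-- If `A^{(3)} = 0`, then every element of `A^{(2)}` acts trivially. -/
theorem braceLam_of_mem_rightSeries_one (h3 : rightSeries mul 2 = ⊥) {z : A}
    (hz : z ∈ rightSeries mul 1) (c : A) : braceLam mul z c = c := by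
  have h : braceStar mul z c ∈ rightSeries mul 2 := AddSubgroup.subset_closure ⟨z, c, hz, rfl⟩
  rw [h3, AddSubgroup.mem_bot] at h
  rw [braceLam_eq_braceStar_add, h, zero_add]

/-- If `A^{(3)} = 0`, then `λ` turns addition into composition. -/
theorem braceLam_add_left (hassoc : ∀ a b c : A, mul (mul a b) c = mul a (mul b c))
    (hzl : ∀ a : A, mul 0 a = a)
    (hinv : ∀ a : A, ∃ b : A, mul a b = 0 ∧ mul b a = 0)
    (hdist : ∀ a b c : A, mul a (b + c) = mul a b - a + mul a c)
    (h3 : rightSeries mul 2 = ⊥) (x y z : A) :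
    braceLam mul (x + y) z = braceLam mul x (braceLam mul y z) := by
  have add_right {u w : A} (hw : w ∈ rightSeries mul 1) (c : A) :
      braceLam mul (u + w) c = braceLam mul u c := by
    obtain ⟨v, huv, -⟩ := hinv u
    have hvw : braceLam mul v w ∈ rightSeries mul 1 := by
      rw [braceLam_eq_braceStar_add]
      exact add_mem (braceStar_mem_rightSeries_one v w) hw
    have huw : u + w = mul u (braceLam mul v w) := by
      rw [mul_eq_add_braceLam mul u, ← braceLam_mul hassoc hdist, huv, braceLam_zero_left hzl]
    rw [huw, braceLam_mul hassoc hdist, braceLam_of_mem_rightSeries_one h3 hvw]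
  rw [← braceLam_mul hassoc hdist, mul_eq_add_braceLam mul, braceLam_eq_braceStar_add x y,
    add_comm (braceStar mul x y), ← add_assoc, add_right (braceStar_mem_rightSeries_one x y)]

theorem iterated_braceStar_mem_leftSeries {a : A} {f : ℕ → A}
    (hf : ∀ j : ℕ, 1 ≤ j → f (j + 1) = braceStar mul a (f j)) (j : ℕ) :
    f (j + 1) ∈ leftSeries mul j := by
  induction j with
  | zero => exact AddSubgroup.mem_top _
  | succ j ih => exact AddSubgroup.subset_closure ⟨a, f (j + 1), ih, hf (j + 1) (by omega)⟩

end LeftBrace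

/-- The additive subgroup of integral combinations of `f 1, …, f m`. -/
def intCombinations {A : Type*} [AddCommGroup A] (m : ℕ) (f : ℕ → A) : AddSubgroup A where
  carrier := {x | ∃ t : ℕ → ℤ, x = ∑ k ∈ Finset.Icc 1 m, t k • f k}
  zero_mem' := ⟨0, by simp⟩
  add_mem' := by
    rintro _ _ ⟨s, rfl⟩ ⟨t, rfl⟩
    exact ⟨s + t, by simp [add_smul, Finset.sum_add_distrib]⟩
  neg_mem' := by
    rintro _ ⟨t, rfl⟩
    exact ⟨-t, by simp⟩

theorem mem_intCombinations {A : Type*} [AddCommGroup A] {m : ℕ} (f : ℕ → A) {k : ℕ}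
    (hk : k ∈ Finset.Icc 1 m) : f k ∈ intCombinations m f :=
  ⟨Pi.single k 1, by simp [Pi.single_apply, ite_smul, Finset.mem_Icc.1 hk]⟩

theorem intCombinations_le {A : Type*} [AddCommGroup A] {m : ℕ} {f : ℕ → A} {T : AddSubgroup A}
    (h : ∀ k ∈ Finset.Icc 1 m, f k ∈ T) : intCombinations m f ≤ T := by
  rintro _ ⟨t, rfl⟩
  exact sum_mem fun k hk => zsmul_mem (h k hk) _

/-- Theorem C: Let `m ≥ 2` and `A` a left brace with `A^{(3)} = A^{m+1} = {0}`.
Let `a ∈ A`, `a_1 = a`, `a_{j+1} = a * a_j`.  Then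
`S = {∑_{k=1}^m t_k·a_k : t_k ∈ ℤ}` is the subbrace of `A` generated by `a`: `S` is an
additive subgroup, closed under `·` and under multiplicative inverses, `a ∈ S`, and `S` is
contained in every subbrace of `A` containing `a`. -/
theorem stmt14 {A : Type*} [AddCommGroup A] (m : ℕ) (hm : 2 ≤ m)
    (mul : A → A → A)
    (hassoc : ∀ a b c : A, mul (mul a b) c = mul a (mul b c))
    (hzl : ∀ a : A, mul 0 a = a)
    (hzr : ∀ a : A, mul a 0 = a)
    (hinv : ∀ a : A, ∃ b : A, mul a b = 0 ∧ mul b a = 0)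
    (hdist : ∀ a b c : A, mul a (b + c) = mul a b - a + mul a c)
    (h3 : rightSeries mul 2 = ⊥) (hL : leftSeries mul m = ⊥)
    (a : A) (f : ℕ → A) (hf1 : f 1 = a)
    (hf : ∀ j : ℕ, 1 ≤ j → f (j + 1) = braceStar mul a (f j))
    (S : Set A) (hS : S = {x | ∃ t : ℕ → ℤ, x = ∑ k ∈ Finset.Icc 1 m, t k • f k}) :
    (0 : A) ∈ S ∧
    (∀ x ∈ S, ∀ y ∈ S, x + y ∈ S) ∧
    (∀ x ∈ S, -x ∈ S) ∧
    (∀ x ∈ S, ∀ y ∈ S, mul x y ∈ S) ∧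
    (∀ x ∈ S, ∀ y : A, mul x y = 0 → mul y x = 0 → y ∈ S) ∧
    a ∈ S ∧
    (∀ T : AddSubgroup A, (∀ x ∈ T, ∀ y ∈ T, mul x y ∈ T) →
      (∀ x ∈ T, ∀ y : A, mul x y = 0 → mul y x = 0 → y ∈ T) → a ∈ T → S ⊆ T) := by
  let N := intCombinations m f
  have hSN (x : A) : x ∈ S ↔ x ∈ N := by subst hS; rfl
  have lam_add := braceLam_add_left hassoc hzl hinv hdist h3
  have lam_neg_lam (x y : A) : braceLam mul (-x) (braceLam mul x y) = y := by
    rw [← lam_add, neg_add_cancel, braceLam_zero_left hzl]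
  have f_last : f (m + 1) = 0 := by
    simpa [hL] using iterated_braceStar_mem_leftSeries hf m
  have lam_mem {x : A} (hx : ∀ k ∈ Finset.Icc 1 m, braceLam mul x (f k) ∈ N) {y : A}
      (hy : y ∈ N) : braceLam mul x y ∈ N :=
    intCombinations_le (T := N.comap (AddMonoidHom.mk' (braceLam mul x) (braceLam_add hdist x)))
      hx hy
  have lam_a (k : ℕ) (hk : 1 ≤ k) : braceLam mul a (f k) = f (k + 1) + f k := by
    rw [braceLam_eq_braceStar_add, hf k hk]
  have succ_mem {k : ℕ} (hk : k ∈ Finset.Icc 1 m) : f (k + 1) ∈ N := by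
    obtain ⟨-, hkm⟩ := Finset.mem_Icc.1 hk
    rcases hkm.eq_or_lt with rfl | h
    · rw [f_last]; exact N.zero_mem
    · exact mem_intCombinations f (Finset.mem_Icc.2 ⟨by omega, h⟩)
  have lam_a_mem {y : A} (hy : y ∈ N) : braceLam mul a y ∈ N :=
    lam_mem (fun k hk => by
      rw [lam_a k (Finset.mem_Icc.1 hk).1]
      exact add_mem (succ_mem hk) (mem_intCombinations f hk)) hy
  have lam_neg_a_f (j : ℕ) : ∀ k, 1 ≤ k → k + j = m + 1 → braceLam mul (-a) (f k) ∈ N := by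
    induction j with
    | zero =>
      rintro k - rfl
      simp [f_last, braceLam, hzr, N.zero_mem]
    | succ j ih =>
      intro k hk hkj
      have h := lam_neg_lam a (f k)
      rw [lam_a k hk, braceLam_add hdist, ← eq_sub_iff_add_eq'] at h
      rw [h]
      exact sub_mem (mem_intCombinations f (Finset.mem_Icc.2 ⟨hk, by omega⟩))
        (ih (k + 1) (by omega) (by omega))
  have lam_neg_a_mem {y : A} (hy : y ∈ N) : braceLam mul (-a) y ∈ N :=
    lam_mem (fun k hk => by
      obtain ⟨h1, hkm⟩ := Finset.mem_Icc.1 hk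
      exact lam_neg_a_f (m + 1 - k) k h1 (by omega)) hy
  let H : AddSubgroup A :=
    { carrier := {x | ∀ y ∈ N, braceLam mul x y ∈ N ∧ braceLam mul (-x) y ∈ N}
      zero_mem' := fun y hy => by simpa [braceLam_zero_left hzl] using hy
      add_mem' := fun {u v} hu hv y hy => by
        rw [neg_add, lam_add, lam_add]
        exact ⟨(hu _ (hv y hy).1).1, (hu _ (hv y hy).2).2⟩
      neg_mem' := fun {u} hu y hy => by
        rw [neg_neg]
        exact (hu y hy).symm }
  have hNH : N ≤ H := intCombinations_le fun k hk y hy => by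
    obtain ⟨h1, -⟩ := Finset.mem_Icc.1 hk
    rcases h1.eq_or_lt with rfl | h
    · rw [hf1]
      exact ⟨lam_a_mem hy, lam_neg_a_mem hy⟩
    · obtain ⟨j, rfl⟩ : ∃ j, k = j + 1 := ⟨k - 1, by omega⟩
      have hfk : f (j + 1) ∈ rightSeries mul 1 := by
        rw [hf j (by omega)]
        exact braceStar_mem_rightSeries_one a (f j)
      rw [braceLam_of_mem_rightSeries_one h3 hfk,
        braceLam_of_mem_rightSeries_one h3 (neg_mem hfk)]
      exact ⟨hy, hy⟩
  simp only [hSN]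
  refine ⟨N.zero_mem, fun x hx y hy => add_mem hx hy, fun x hx => neg_mem hx,
    fun x hx y hy => ?_, fun x hx y hxy _ => ?_, ?_, fun T hmul _ ha x hx => ?_⟩
  · rw [mul_eq_add_braceLam mul]
    exact add_mem hx (hNH hx y hy).1
  · rw [mul_eq_add_braceLam mul, add_eq_zero_iff_neg_eq] at hxy
    rw [← lam_neg_lam x y, ← hxy]
    exact (hNH hx _ (neg_mem hx)).2
  · rw [← hf1]
    exact mem_intCombinations f (Finset.mem_Icc.2 ⟨le_rfl, by omega⟩)
  · refine intCombinations_le (fun k hk => ?_) ((hSN x).1 hx)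
    refine Nat.le_induction (by rwa [hf1]) (fun j hj ih => ?_) k (Finset.mem_Icc.1 hk).1
    rw [hf j hj]
    exact sub_mem (add_mem (neg_mem ha) (hmul a ha _ ih)) ih
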